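/- arXiv:1909.02773 — 3 statements merged into one kernel-verified Lean document; each statement's English description precedes it below -/
import Mathlib

section
/- Let J be a join of G, let e ∈ J, and let J' be any subset of J \ {e}. Then the squarefree monomial ∏_{f ∈ J'} t_f does not belong to the ideal I(X_G) + (t_e) of K[E_G]. -/
open MvPolynomial

/-- The polynomial `x_i * x_j` associated to an edge `e = {i, j}`. -/
noncomputable def edgePoly {V : Type} (K : Type) [CommRing K] (e : Sym2 V) :
    MvPolynomial V K :=
  Sym2.lift ⟨fun i j => X i * X j, fun _ _ => mul_comm _ _⟩ e

/-- The map `θ : K[E_G] → K[V_G]`, sending `t_e` to `x_i * x_j` for `e = {i, j}`. -/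
noncomputable def thetaG {V : Type} (K : Type) [CommRing K] (G : SimpleGraph V) :
    MvPolynomial G.edgeSet K →ₐ[K] MvPolynomial V K :=
  aeval fun e => edgePoly K (e : Sym2 V)

/-- The ideal `J_V = (x_i² - x_j² : i, j ∈ V)` of `K[V_G]`. -/
noncomputable def JV (V K : Type) [CommRing K] : Ideal (MvPolynomial V K) :=
  Ideal.span {f | ∃ i j : V, f = X i ^ 2 - X j ^ 2}

/-- The ideal `I(X_G) = θ⁻¹(J_V)` of `K[E_G]`. -/
noncomputable def IX {V : Type} (K : Type) [CommRing K] (G : SimpleGraph V) :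
    Ideal (MvPolynomial G.edgeSet K) :=
  Ideal.comap (thetaG K G) (JV V K)

/-- A join of `G`: a set of edges `J ⊆ E_G` such that for every circuit `C` of `G`
(a closed walk of positive length with no repeated edges), `|J ∩ E_C| ≤ |E_C| / 2`. -/
def IsJoin {V : Type} [DecidableEq V] (G : SimpleGraph V) (J : Finset (Sym2 V)) : Prop :=
  ↑J ⊆ G.edgeSet ∧
    ∀ (v : V) (w : G.Walk v v), w.IsCircuit →
      2 * (J ∩ w.edges.toFinset).card ≤ w.edges.toFinset.card

theorem finsupp_zmod_two_add_self {V : Type} (x : V →₀ ZMod 2) : x + x = 0 :=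
  Finsupp.ext fun _ => CharTwo.add_self_eq_zero _

/-- The mod-2 boundary `δ_i + δ_j` of an edge `{i, j}`. -/
noncomputable def edgeBoundary {V : Type} (e : Sym2 V) : V →₀ ZMod 2 :=
  Sym2.lift ⟨fun i j => Finsupp.single i 1 + Finsupp.single j 1, fun _ _ => add_comm _ _⟩ e

/-- The homomorphism on `K[V_G]` recording the degree and the parity vector of each monomial. -/
noncomputable def parityHom (V K : Type) [CommRing K] :
    MvPolynomial V K →ₐ[K] AddMonoidAlgebra K (ℕ × (V →₀ ZMod 2)) :=
  aeval fun v => AddMonoidAlgebra.single (1, Finsupp.single v 1) 1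

theorem parityHom_eq_zero_of_mem_JV {V K : Type} [CommRing K] {p : MvPolynomial V K}
    (hp : p ∈ JV V K) : parityHom V K p = 0 := by
  suffices h : JV V K ≤ RingHom.ker (parityHom V K) from h hp
  refine Ideal.span_le.2 ?_
  rintro _ ⟨i, j, rfl⟩
  have h (v : V) : (2 : ℕ) • Finsupp.single v (1 : ZMod 2) = 0 := by
    rw [two_nsmul, finsupp_zmod_two_add_self]
  simp [RingHom.mem_ker, parityHom, AddMonoidAlgebra.single_pow, h]

theorem parityHom_edgePoly {V K : Type} [CommRing K] (e : Sym2 V) :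
    parityHom V K (edgePoly K e) = AddMonoidAlgebra.single (2, edgeBoundary e) 1 := by
  induction e with
  | _ i j => simp [edgePoly, edgeBoundary, parityHom, AddMonoidAlgebra.single_mul_single]

theorem parityHom_thetaG_monomial {V K : Type} [CommRing K] (G : SimpleGraph V)
    (k : G.edgeSet →₀ ℕ) (c : K) :
    parityHom V K (thetaG K G (monomial k c)) =
      AddMonoidAlgebra.single
        (k.sum fun f a => a • ((2, edgeBoundary f.1) : ℕ × (V →₀ ZMod 2))) c := by
  induction k using Finsupp.induction generalizing c with
  | zero => simp [thetaG, ← C_apply]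
  | single_add f a k hf ha ih =>
    rw [Finsupp.sum_add_index' (by simp) (by intros; rw [add_smul]),
      Finsupp.sum_single_index (by simp), ← one_mul c, ← monomial_mul, map_mul, map_mul, ih,
      ← X_pow_eq_monomial, map_pow, map_pow, thetaG, aeval_X, parityHom_edgePoly,
      AddMonoidAlgebra.single_pow, AddMonoidAlgebra.single_mul_single]
    simp

/-- If the class `w` occurs in the image of `q`, some monomial of `q` has class `w`. -/
theorem exists_mem_support_of_coeff_parityHom_ne_zero {V K : Type} [CommRing K]
    (G : SimpleGraph V) {q : MvPolynomial G.edgeSet K} {w : ℕ × (V →₀ ZMod 2)}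
    (h : (parityHom V K (thetaG K G q)).coeff w ≠ 0) :
    ∃ k ∈ q.support,
      (k.sum fun f a => a • ((2, edgeBoundary f.1) : ℕ × (V →₀ ZMod 2))) = w := by
  classical
  contrapose! h
  rw [q.as_sum, map_sum, map_sum, AddMonoidAlgebra.coeff_sum, Finsupp.finsetSum_apply]
  refine Finset.sum_eq_zero fun k hk => ?_
  rw [parityHom_thetaG_monomial, AddMonoidAlgebra.coeff_single, Finsupp.single_apply,
    if_neg (h k hk)]

theorem sum_edgeBoundary_edges {V : Type} {G : SimpleGraph V} {u v : V} (w : G.Walk u v) :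
    (w.edges.map edgeBoundary).sum = Finsupp.single u 1 + Finsupp.single v 1 := by
  induction w with
  | nil => simp [finsupp_zmod_two_add_self]
  | @cons u v x h p ih =>
    simp only [SimpleGraph.Walk.edges_cons, List.map_cons, List.sum_cons, ih]
    have : edgeBoundary s(u, v) = Finsupp.single u 1 + Finsupp.single v 1 := rfl
    rw [this, add_assoc, ← add_assoc (Finsupp.single v 1), finsupp_zmod_two_add_self, zero_add]

/-- A nonempty set of edges with zero mod-2 boundary contains a cycle through each edge. -/
theorem exists_isCycle_of_sum_edgeBoundary_eq_zero {V : Type} [DecidableEq V]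
    {G : SimpleGraph V} {D : Finset (Sym2 V)} (hD : ↑D ⊆ G.edgeSet)
    (hsum : ∑ f ∈ D, edgeBoundary f = 0) {e : Sym2 V} (he : e ∈ D) :
    ∃ (v : V) (w : G.Walk v v), w.IsCycle ∧ w.edges.toFinset ⊆ D ∧ e ∈ w.edges.toFinset := by
  classical
  set H := SimpleGraph.fromEdgeSet (D : Set (Sym2 V)) with hH
  have hedge : H.edgeSet = D := by
    rw [hH, SimpleGraph.edgeSet_fromEdgeSet, sdiff_eq_left, Set.disjoint_left]
    exact fun f hf => G.not_isDiag_of_mem_edgeSet (hD hf)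
  have hle : H ≤ G := by
    rw [← SimpleGraph.edgeSet_subset_edgeSet, hedge]
    exact hD
  have hbridge : ¬ H.IsBridge e := by
    induction e with
    | _ a b =>
    rw [SimpleGraph.isBridge_iff]
    intro hab
    let L : (V →₀ ZMod 2) →ₗ[ZMod 2] ZMod 2 := Finsupp.linearCombination (ZMod 2)
      fun v => if (H.deleteEdges {s(a, b)}).Reachable a v then 1 else 0
    have hL : ∑ f ∈ D, L (edgeBoundary f) = 0 := by rw [← map_sum, hsum, map_zero]
    rw [← Finset.add_sum_erase _ _ he, Finset.sum_eq_zero, add_zero] at hL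
    · simp [L, edgeBoundary, hab] at hL
    · intro f hf
      induction f with
      | _ c d =>
      have hcd : (H.deleteEdges {s(a, b)}).Adj c d := by
        rw [SimpleGraph.deleteEdges_adj, ← SimpleGraph.mem_edgeSet, hedge]
        exact ⟨Finset.mem_of_mem_erase hf, Finset.ne_of_mem_erase hf⟩
      have hiff : (H.deleteEdges {s(a, b)}).Reachable a c ↔
          (H.deleteEdges {s(a, b)}).Reachable a d :=
        ⟨fun h => h.trans hcd.reachable, fun h => h.trans hcd.symm.reachable⟩
      simp [L, edgeBoundary, hiff, CharTwo.add_self_eq_zero]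
  have heH : e ∈ H.edgeSet := by rw [hedge]; exact he
  rw [SimpleGraph.isBridge_iff_forall_cycle_notMem heH] at hbridge
  push Not at hbridge
  obtain ⟨v, w, hw, hew⟩ := hbridge
  refine ⟨v, w.mapLe hle, hw.mapLe hle, ?_, by simpa using hew⟩
  intro f hf
  have : f ∈ H.edgeSet := w.edges_subset_edgeSet (by simpa using hf)
  rwa [hedge] at this

/-- A join meets each even edge set in at most half of its edges. -/
theorem IsJoin.two_mul_card_inter_le {V : Type} [DecidableEq V] {G : SimpleGraph V}
    {J : Finset (Sym2 V)} (hJ : IsJoin G J) {D : Finset (Sym2 V)} (hD : ↑D ⊆ G.edgeSet)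
    (hsum : ∑ f ∈ D, edgeBoundary f = 0) : 2 * (J ∩ D).card ≤ D.card := by
  induction D using Finset.strongInduction with
  | H D ih =>
  obtain rfl | ⟨e, he⟩ := D.eq_empty_or_nonempty
  · simp
  obtain ⟨v, w, hw, hsub, hew⟩ := exists_isCycle_of_sum_edgeBoundary_eq_zero hD hsum he
  have hC := hJ.2 v w hw.isCircuit
  have hCsum : ∑ f ∈ w.edges.toFinset, edgeBoundary f = 0 := by
    rw [List.sum_toFinset _ hw.isCircuit.isTrail.edges_nodup, sum_edgeBoundary_edges,
      finsupp_zmod_two_add_self]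
  generalize w.edges.toFinset = C at *
  have hrec := ih (D \ C) (Finset.sdiff_ssubset hsub ⟨e, hew⟩)
    (fun f hf => hD (Finset.sdiff_subset hf)) (by
      rw [← Finset.sum_sdiff hsub, hCsum, add_zero] at hsum
      exact hsum)
  have hcard := Finset.card_sdiff_add_card_eq_card hsub
  have hinter : (J ∩ D).card ≤ (J ∩ (D \ C)).card + (J ∩ C).card := by
    rw [← Finset.sdiff_union_of_subset hsub, Finset.inter_union_distrib_left,
      Finset.sdiff_union_of_subset hsub]
    exact Finset.card_union_le _ _
  omega

/-- A subset of a join is a smallest edge set with its boundary, and any other smallest such set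
is disjoint from the rest of the join. -/
theorem IsJoin.card_add_two_mul_card_le {V : Type} [DecidableEq V] {G : SimpleGraph V}
    {J : Finset (Sym2 V)} (hJ : IsJoin G J) {J' S : Finset (Sym2 V)} (hJ' : J' ⊆ J)
    (hS : ↑S ⊆ G.edgeSet) (hsum : ∑ f ∈ S, edgeBoundary f = ∑ f ∈ J', edgeBoundary f) :
    J'.card + 2 * ((J ∩ S) \ J').card ≤ S.card := by
  have hdisj : Disjoint (S \ J') (J' \ S) := by
    rw [Finset.disjoint_left]; grind
  have hD := hJ.two_mul_card_inter_le (D := (S \ J') ∪ (J' \ S))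
    (by
      intro f hf
      simp only [Finset.coe_union, Finset.coe_sdiff, Set.mem_union, Set.mem_sdiff,
        Finset.mem_coe] at hf
      exact hf.elim (fun h => hS h.1) (fun h => hJ.1 (hJ' h.1)))
    (by
      rw [Finset.sum_union hdisj]
      rw [← Finset.sum_inter_add_sum_sdiff S J', ← Finset.sum_inter_add_sum_sdiff J' S,
        Finset.inter_comm J' S] at hsum
      rw [add_left_cancel hsum, finsupp_zmod_two_add_self])
  rw [Finset.card_union_of_disjoint hdisj] at hD
  have hJD : J ∩ ((S \ J') ∪ (J' \ S)) = ((J ∩ S) \ J') ∪ (J' \ S) := by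
    ext f; have := @hJ' f; grind
  rw [hJD, Finset.card_union_of_disjoint (by rw [Finset.disjoint_left]; grind)] at hD
  have h₁ := Finset.card_sdiff_add_card_inter S J'
  have h₂ := Finset.card_sdiff_add_card_inter J' S
  rw [Finset.inter_comm] at h₂
  omega

/-- If `J` is a join of `G`, `e ∈ J`, and `J' ⊆ J \ {e}`, then the squarefree monomial
`∏_{f ∈ J'} t_f` does not belong to the ideal `I(X_G) + (t_e)`. -/
theorem stmt13 {V K : Type} [DecidableEq V] [Field K] (G : SimpleGraph V)
    (hG : ∀ v : V, ∃ w : V, G.Adj v w)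
    (J : Finset (Sym2 V)) (hJ : IsJoin G J)
    (e : Sym2 V) (he : e ∈ J)
    (J' : Finset (Sym2 V)) (hJ' : J' ⊆ J.erase e) :
    (∏ f ∈ J'.attach,
        (X (⟨f.1, hJ.1 (Finset.mem_coe.mpr (Finset.mem_of_mem_erase (hJ' f.2)))⟩ :
          G.edgeSet) : MvPolynomial G.edgeSet K)) ∉
      IX K G ⊔ Ideal.span {X (⟨e, hJ.1 (Finset.mem_coe.mpr he)⟩ : G.edgeSet)} := by
  intro hmem
  obtain ⟨h, hh, q, hq, hsum⟩ := Submodule.mem_sup.1 hmem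
  have hlhs : parityHom V K (thetaG K G (∏ f ∈ J'.attach,
        (X (⟨f.1, hJ.1 (Finset.mem_coe.mpr (Finset.mem_of_mem_erase (hJ' f.2)))⟩ :
          G.edgeSet) : MvPolynomial G.edgeSet K))) =
      AddMonoidAlgebra.single (∑ f ∈ J', (2, edgeBoundary f)) 1 := by
    simp only [map_prod, thetaG, aeval_X, parityHom_edgePoly]
    rw [← Finset.sum_attach]
    induction J'.attach using Finset.induction_on with
    | empty => simp [AddMonoidAlgebra.one_def]
    | insert f s hf ih =>
      rw [Finset.prod_insert hf, Finset.sum_insert hf, ih, AddMonoidAlgebra.single_mul_single,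
        one_mul]
  rw [← hsum, map_add, map_add, parityHom_eq_zero_of_mem_JV (p := thetaG K G h) hh,
    zero_add] at hlhs
  obtain ⟨k, hk, hkw⟩ := exists_mem_support_of_coeff_parityHom_ne_zero G (q := q)
    (w := ∑ f ∈ J', (2, edgeBoundary f)) (by simp [hlhs])
  have hke : k ⟨e, hJ.1 (Finset.mem_coe.mpr he)⟩ ≠ 0 := by
    rw [← Set.image_singleton, mem_ideal_span_X_image] at hq
    simpa using hq k hk
  have hdeg : ∑ f ∈ k.support, k f = J'.card := by
    have := congrArg Prod.fst hkw
    simp only [Finsupp.sum, Prod.fst_sum, Prod.smul_mk, smul_eq_mul, Finset.sum_const] at this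
    rw [← Finset.sum_mul] at this
    omega
  have hbd : ∑ f ∈ k.support, k f • edgeBoundary f.1 = ∑ f ∈ J', edgeBoundary f := by
    have := congrArg Prod.snd hkw
    simpa only [Finsupp.sum, Prod.snd_sum, Prod.smul_mk] using this
  set T := k.support.filter fun f => Odd (k f) with hT
  have hTbd : ∑ f ∈ T.map (Function.Embedding.subtype _), edgeBoundary f =
      ∑ f ∈ J', edgeBoundary f := by
    rw [Finset.sum_map, ← hbd, hT, Finset.sum_filter]
    refine Finset.sum_congr rfl fun f _ => ?_
    split_ifs with hf
    · obtain ⟨m, hm⟩ := hf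
      rw [hm, add_smul, mul_smul, two_nsmul, finsupp_zmod_two_add_self, zero_add, one_smul]
      rfl
    · obtain ⟨m, hm⟩ := Nat.not_odd_iff_even.1 hf
      rw [hm, add_smul, finsupp_zmod_two_add_self]
  have hcard := hJ.card_add_two_mul_card_le (hJ'.trans (Finset.erase_subset _ _))
    (S := T.map (Function.Embedding.subtype _)) (by
      intro f hf
      obtain ⟨g, -, rfl⟩ := Finset.mem_map.1 (Finset.mem_coe.1 hf)
      exact g.2) hTbd
  rw [Finset.card_map, ← hdeg] at hcard
  have hTk : T.card = ∑ f ∈ k.support, if Odd (k f) then 1 else 0 := by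
    rw [hT, Finset.card_filter]
  have hle : ∀ f ∈ k.support, (if Odd (k f) then 1 else 0) ≤ k f := by
    intro f hf
    have := Finsupp.mem_support_iff.1 hf
    split_ifs <;> omega
  by_cases hodd : Odd (k ⟨e, hJ.1 (Finset.mem_coe.mpr he)⟩)
  · have heS : e ∈ (J ∩ T.map (Function.Embedding.subtype _)) \ J' := by
      refine Finset.mem_sdiff.2 ⟨Finset.mem_inter.2 ⟨he, Finset.mem_map.2
        ⟨_, Finset.mem_filter.2 ⟨Finsupp.mem_support_iff.2 hke, hodd⟩, rfl⟩⟩, fun h => ?_⟩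
      exact Finset.notMem_erase e J (hJ' h)
    have hpos := Finset.card_pos.2 ⟨e, heS⟩
    have := Finset.sum_le_sum hle
    omega
  · have := Finset.sum_lt_sum hle ⟨_, Finsupp.mem_support_iff.2 hke, by
      rw [if_neg hodd]
      exact Nat.pos_of_ne_zero hke⟩
    omega
end

section
/- Suppose G is bipartite (2-colorable). Then for every edge e ∈ E_G and every α ∈ ℕ^{E_G} with Σ_e α(e) = μ(G), the monomial t^α belongs to the ideal I(X_G) + (t_e) of K[E_G]. -/
open MvPolynomial

/-- The degree of a vertex `v` in the multiset of edges with multiplicities `α`. -/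
def multidegree {V : Type} [DecidableEq V] (G : SimpleGraph V) [Fintype G.edgeSet]
    (α : G.edgeSet → ℕ) (v : V) : ℕ :=
  ∑ f : G.edgeSet, (if v ∈ (f : Sym2 V) then 1 else 0) * α f

theorem sum_ite_mem_edge {V : Type} [Fintype V] [DecidableEq V] (G : SimpleGraph V)
    {f : Sym2 V} (hf : f ∈ G.edgeSet) : ∑ v, (if v ∈ f then 1 else 0) = 2 := by
  induction f with
  | _ i j =>
    have hij : i ≠ j := G.ne_of_adj hf
    rw [← Finset.card_filter, ← Finset.card_pair hij]
    congr 1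
    ext v
    simp

theorem edgePoly_eq_prod {V K : Type} [Fintype V] [DecidableEq V] [CommRing K]
    (G : SimpleGraph V) {f : Sym2 V} (hf : f ∈ G.edgeSet) :
    edgePoly K f = ∏ v, (X v : MvPolynomial V K) ^ (if v ∈ f then 1 else 0) := by
  induction f with
  | _ i j =>
    have hij : i ≠ j := G.ne_of_adj hf
    simp only [pow_ite, pow_one, pow_zero]
    rw [← Finset.prod_filter]
    have : Finset.univ.filter (fun v => v ∈ s(i, j)) = {i, j} := by
      ext v
      simp
    rw [this, Finset.prod_pair hij]
    rfl

theorem thetaG_monomial {V K : Type} [Fintype V] [DecidableEq V] [CommRing K]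
    (G : SimpleGraph V) [Fintype G.edgeSet] (α : G.edgeSet →₀ ℕ) :
    thetaG K G (monomial α 1) = ∏ v, X v ^ multidegree G α v := by
  rw [thetaG, aeval_monomial, map_one, one_mul, Finsupp.prod_fintype _ _ (by simp)]
  simp_rw [fun f : G.edgeSet => edgePoly_eq_prod (K := K) G f.2, ← Finset.prod_pow, ← pow_mul]
  rw [Finset.prod_comm]
  simp_rw [Finset.prod_pow_eq_pow_sum]
  rfl

theorem sum_multidegree {V : Type} [Fintype V] [DecidableEq V] (G : SimpleGraph V)
    [Fintype G.edgeSet] (α : G.edgeSet → ℕ) : ∑ v, multidegree G α v = 2 * ∑ f, α f := by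
  simp_rw [multidegree]
  rw [Finset.sum_comm, Finset.mul_sum]
  exact Finset.sum_congr rfl fun f _ => by rw [← Finset.sum_mul, sum_ite_mem_edge G f.2]

theorem prod_pow_eq_of_sq_eq {V R : Type*} [Fintype V] [CommMonoid R] {y : V → R} {c : R}
    (hy : ∀ v, y v ^ 2 = c) {a b : V → ℕ} (hsum : ∑ v, a v = ∑ v, b v)
    (hpar : ∀ v, a v % 2 = b v % 2) : ∏ v, y v ^ a v = ∏ v, y v ^ b v := by
  have key : ∀ d : V → ℕ, ∏ v, y v ^ d v = (∏ v, y v ^ (d v % 2)) * c ^ ∑ v, d v / 2 := by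
    intro d
    rw [← Finset.prod_pow_eq_pow_sum, ← Finset.prod_mul_distrib]
    refine Finset.prod_congr rfl fun v _ => ?_
    rw [← hy v, ← pow_mul, ← pow_add, Nat.mod_add_div]
  have split : ∀ d : V → ℕ, ∑ v, d v = ∑ v, d v % 2 + 2 * ∑ v, d v / 2 := by
    intro d
    rw [Finset.mul_sum, ← Finset.sum_add_distrib]
    exact Finset.sum_congr rfl fun v _ => (Nat.mod_add_div _ _).symm
  have hsa := split a
  have hsb := split b
  rw [key a, key b]
  simp_rw [hpar] at hsa ⊢
  congr 2
  omega

theorem monomial_sub_monomial_mem_IX {V K : Type} [Fintype V] [DecidableEq V] [CommRing K]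
    (G : SimpleGraph V) [Fintype G.edgeSet] {α β : G.edgeSet →₀ ℕ}
    (hsum : ∑ f, α f = ∑ f, β f)
    (hpar : ∀ v, multidegree G α v % 2 = multidegree G β v % 2) :
    (monomial α (1 : K) - monomial β 1) ∈ IX K G := by
  rw [IX, Ideal.mem_comap, map_sub, thetaG_monomial, thetaG_monomial,
    ← Ideal.Quotient.mk_eq_mk_iff_sub_mem]
  simp_rw [map_prod, map_pow]
  rcases isEmpty_or_nonempty V with hV | ⟨⟨v₀⟩⟩
  · simp
  refine prod_pow_eq_of_sq_eq (c := Ideal.Quotient.mk (JV V K) (X v₀) ^ 2) (fun v => ?_) ?_ hpar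
  · rw [← map_pow, ← map_pow, Ideal.Quotient.mk_eq_mk_iff_sub_mem]
    exact Ideal.subset_span ⟨v, v₀, rfl⟩
  · rw [sum_multidegree, sum_multidegree, hsum]

theorem multidegree_add {V : Type} [DecidableEq V] (G : SimpleGraph V) [Fintype G.edgeSet]
    (α β : G.edgeSet → ℕ) (v : V) :
    multidegree G (α + β) v = multidegree G α v + multidegree G β v := by
  simp [multidegree, mul_add, Finset.sum_add_distrib]

theorem multidegree_two_mul {V : Type} [DecidableEq V] (G : SimpleGraph V)
    [Fintype G.edgeSet] (γ : G.edgeSet → ℕ) (v : V) :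
    multidegree G (fun f => 2 * γ f) v = 2 * multidegree G γ v := by
  simp only [multidegree, Finset.mul_sum]
  exact Finset.sum_congr rfl fun f _ => by ring

theorem monomial_mem_of_parity {V K : Type} [Fintype V] [DecidableEq V] [CommRing K]
    (G : SimpleGraph V) [Fintype G.edgeSet] (e : G.edgeSet) {α : G.edgeSet →₀ ℕ}
    (β : G.edgeSet → ℕ) {k : ℕ} (hsum : ∑ f, α f = ∑ f, β f + 2 * k)
    (hpar : ∀ v, multidegree G α v % 2 = multidegree G β v % 2) (hpos : 0 < β e + k) :
    (monomial α (1 : K)) ∈ IX K G ⊔ Ideal.span {X e} := by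
  classical
  set γ : G.edgeSet →₀ ℕ := Finsupp.equivFunOnFinite.symm (β + fun f => 2 * if f = e then k else 0)
    with hγ
  have hγc : (γ : G.edgeSet → ℕ) = β + fun f => 2 * if f = e then k else 0 := rfl
  rw [← sub_add_cancel (monomial α (1 : K)) (monomial γ 1)]
  refine Ideal.add_mem _ (Ideal.mem_sup_left (monomial_sub_monomial_mem_IX G ?_ ?_))
    (Ideal.mem_sup_right ?_)
  · simp [hγc, hsum, Finset.sum_add_distrib]
  · intro v
    rw [hpar, hγc, multidegree_add, multidegree_two_mul]
    omega
  · rw [Ideal.mem_span_singleton, X_dvd_monomial]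
    right
    have : γ e = β e + 2 * k := by simp [hγc]
    omega

theorem sum_edgeSet_ite_mem {V : Type} [DecidableEq V] (G : SimpleGraph V) [Fintype G.edgeSet]
    {S : Finset (Sym2 V)} (hS : (S : Set (Sym2 V)) ⊆ G.edgeSet) :
    ∑ f : G.edgeSet, (if (f : Sym2 V) ∈ S then 1 else 0) = S.card := by
  rw [← Finset.card_filter]
  refine Finset.card_bij (fun f _ => (f : Sym2 V)) (by simp) (by simp) fun f hf => ?_
  exact ⟨⟨f, hS hf⟩, by simpa using hf, rfl⟩

theorem even_multidegree_closed_trail {V : Type} [DecidableEq V] (G : SimpleGraph V)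
    [Fintype G.edgeSet] {u : V} {w : G.Walk u u} (hw : w.IsTrail) (v : V) :
    Even (multidegree G (fun f => if (f : Sym2 V) ∈ w.edges.toFinset then 1 else 0) v) := by
  have h := (hw.even_countP_edges_iff v).2 fun h => absurd rfl h
  have hS : (w.edges.toFinset.filter (v ∈ ·) : Set (Sym2 V)) ⊆ G.edgeSet := by
    intro f hf
    simp only [Finset.coe_filter, List.mem_toFinset] at hf
    exact w.edges_subset_edgeSet hf.1
  convert h
  rw [List.countP_eq_length_filter, ← List.toFinset_card_of_nodup (hw.edges_nodup.filter _),
    List.toFinset_filter]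
  simp only [decide_eq_true_eq]
  rw [← sum_edgeSet_ite_mem G hS, multidegree]
  refine Finset.sum_congr rfl fun f _ => ?_
  by_cases h1 : v ∈ (f : Sym2 V) <;> by_cases h2 : (f : Sym2 V) ∈ w.edges <;> simp [h1, h2]

/-- If `G` is bipartite, `μ` is the maximum cardinality of a join of `G`, and `e` is any
edge, then every monomial of degree `μ` belongs to `I(X_G) + (t_e)`. -/
theorem stmt14 {V K : Type} [Fintype V] [DecidableEq V] [Field K] (G : SimpleGraph V)
    (hG : ∀ v : V, ∃ w : V, G.Adj v w) (hbip : G.Colorable 2)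
    (μ : ℕ)
    (hμ : IsGreatest {n : ℕ | ∃ J : Finset (Sym2 V), IsJoin G J ∧ J.card = n} μ)
    (e : Sym2 V) (he : e ∈ G.edgeSet)
    (α : G.edgeSet →₀ ℕ) (hα : (α.sum fun _ m => m) = μ) :
    (monomial α (1 : K) : MvPolynomial G.edgeSet K) ∈
      IX K G ⊔ Ideal.span {X (⟨e, he⟩ : G.edgeSet)} := by
  classical
  rw [Finsupp.sum_fintype _ _ (by simp)] at hα
  by_cases hαe : 0 < α ⟨e, he⟩
  · exact monomial_mem_of_parity G ⟨e, he⟩ α (k := 0) (by simp) (fun _ => rfl) (by omega)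
  by_cases htwo : ∃ f, 2 ≤ α f
  · obtain ⟨f, hf⟩ := htwo
    have hdec : (α : G.edgeSet → ℕ) =
        (fun g => if g = f then α f - 2 else α g) + fun g => 2 * if g = f then 1 else 0 := by
      funext g
      by_cases hgf : g = f
      · subst hgf
        simp [hf]
      · simp [hgf]
    refine monomial_mem_of_parity G ⟨e, he⟩ (fun g => if g = f then α f - 2 else α g)
      (k := 1) ?_ (fun v => ?_) (by omega)
    · conv_lhs => rw [hdec]
      simp [Finset.sum_add_distrib]
    · conv_lhs => rw [hdec, multidegree_add, multidegree_two_mul]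
      omega
  push Not at htwo
  set A : Finset (Sym2 V) := (Finset.univ.filter fun f : G.edgeSet => α f = 1).image (↑) with hA
  have hAmem : ∀ f : G.edgeSet, (f : Sym2 V) ∈ A ↔ α f = 1 := by
    intro f
    simp [hA]
  have hAsub : (A : Set (Sym2 V)) ⊆ G.edgeSet := by
    intro f hf
    simp only [hA, Finset.coe_image] at hf
    obtain ⟨g, -, rfl⟩ := hf
    exact g.2
  have hαA : ∀ f, α f = if (f : Sym2 V) ∈ A then 1 else 0 := by
    intro f
    have := htwo f
    simp only [hAmem]
    split_ifs <;> omega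
  have heA : e ∉ A := by
    rw [hAmem ⟨e, he⟩]
    omega
  have hAcard : A.card = μ := by
    rw [← sum_edgeSet_ite_mem G hAsub, ← hα]
    exact Finset.sum_congr rfl fun f _ => (hαA f).symm
  have hnot : ¬ IsJoin G (insert e A) := by
    intro hJ
    have := hμ.2 ⟨_, hJ, rfl⟩
    rw [Finset.card_insert_of_notMem heA] at this
    omega
  have hins : ((insert e A : Finset (Sym2 V)) : Set (Sym2 V)) ⊆ G.edgeSet := by
    rw [Finset.coe_insert]
    exact Set.insert_subset he hAsub
  simp only [IsJoin, hins, true_and, not_forall, not_le] at hnot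
  obtain ⟨u, w, hw, hlt⟩ := hnot
  set C := w.edges.toFinset with hC
  have hCsub : (C : Set (Sym2 V)) ⊆ G.edgeSet := by
    intro f hf
    exact w.edges_subset_edgeSet (by simpa [hC] using hf)
  have hCeven : Even C.card := by
    rw [hC, List.toFinset_card_of_nodup hw.isTrail.edges_nodup, SimpleGraph.Walk.length_edges]
    exact SimpleGraph.two_colorable_iff_forall_loop_even.1 hbip u w
  have hinter : ((insert e A) ∩ C).card = (A ∩ C).card + if e ∈ C then 1 else 0 := by
    split_ifs with h
    · rw [Finset.insert_inter_of_mem h, Finset.card_insert_of_notMem (by simp [heA])]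
    · rw [Finset.insert_inter_of_notMem h, add_zero]
  set β : G.edgeSet → ℕ := fun f => if (f : Sym2 V) ∈ C then 1 - α f else α f with hβ
  have hflip : ∀ f, α f + (if (f : Sym2 V) ∈ C then 1 else 0) =
      β f + 2 * if (f : Sym2 V) ∈ A ∩ C then 1 else 0 := by
    intro f
    by_cases h1 : (f : Sym2 V) ∈ A <;> by_cases h2 : (f : Sym2 V) ∈ C <;>
      simp [hβ, hαA, h1, h2]
  have hsum : ∑ f, α f + C.card = ∑ f, β f + 2 * (A ∩ C).card := by
    rw [← sum_edgeSet_ite_mem G hCsub, ← sum_edgeSet_ite_mem G (S := A ∩ C)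
      (fun f hf => hAsub (Finset.mem_inter.1 hf).1), Finset.mul_sum, ← Finset.sum_add_distrib,
      ← Finset.sum_add_distrib]
    exact Finset.sum_congr rfl fun f _ => hflip f
  have hβe : β ⟨e, he⟩ = if e ∈ C then 1 else 0 := by
    simp only [hβ]
    split_ifs <;> omega
  obtain ⟨m, hm⟩ := hCeven
  refine monomial_mem_of_parity G ⟨e, he⟩ β (k := (A ∩ C).card - m) ?_ (fun v => ?_) ?_
  · split_ifs at hinter <;> omega
  · have h := even_multidegree_closed_trail G hw.isTrail v
    have h' : multidegree G (⇑α + fun f : G.edgeSet => if (f : Sym2 V) ∈ C then 1 else 0) v =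
        multidegree G (β + fun f : G.edgeSet => 2 * if (f : Sym2 V) ∈ A ∩ C then 1 else 0) v := by
      congr 1
      exact funext hflip
    rw [multidegree_add, multidegree_add, multidegree_two_mul] at h'
    rw [← hC, Nat.even_iff] at h
    omega
  · rw [hβe]
    split_ifs at hinter ⊢ <;> omega
end

section
/- Suppose G is bipartite (2-colorable) and let b0(G) denote the number of connected components of G. Then for every edge e ∈ E_G, every homogeneous polynomial f ∈ K[E_G] of degree |V_G| − b0(G) belongs to the ideal I(X_G) + (t_e). (This is a regularity-free formulation of the bound reg I(X_G) ≤ |V_G| − b0(G) for bipartite graphs.) -/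
open MvPolynomial

/-- If every `w i` and `w₀` lie in a subspace `W` of dimension at most `|ι|` and a functional takes
the value `1` on all of them, then some nonempty subfamily of `w` sums to a multiple of `w₀`, the
factor being the size of the subfamily. -/
lemma exists_nonempty_sum_eq_card_smul {M ι : Type*} [AddCommGroup M] [Module (ZMod 2) M]
    [Module.Finite (ZMod 2) M] [Fintype ι] (W : Submodule (ZMod 2) M)
    (hW : Module.finrank (ZMod 2) W ≤ Fintype.card ι) (w : ι → M) (w₀ : M)
    (hw : ∀ i, w i ∈ W) (hw₀ : w₀ ∈ W) (ε : M →ₗ[ZMod 2] ZMod 2)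
    (hε : ∀ i, ε (w i) = 1) (hε₀ : ε w₀ = 1) :
    ∃ S : Finset ι, S.Nonempty ∧ ∑ i ∈ S, w i = (S.card : ZMod 2) • w₀ := by
  classical
  let u : Option ι → W := fun o => o.elim ⟨w₀, hw₀⟩ fun i => ⟨w i, hw i⟩
  have hdep : ¬ LinearIndependent (ZMod 2) u := fun h => by
    have := h.fintype_card_le_finrank
    rw [Fintype.card_option] at this
    omega
  obtain ⟨g, hg, o, ho⟩ := Fintype.not_linearIndependent_iff.1 hdep
  have hrel : g none • w₀ + ∑ i, g (some i) • w i = 0 := by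
    simpa [Fintype.sum_option, u] using congrArg W.subtype hg
  have hbit : ∀ a : ZMod 2, a = 0 ∨ a = 1 := by decide
  have hsum : ∑ i, g (some i) • w i = ∑ i with g (some i) = 1, w i := by
    rw [Finset.sum_filter]
    refine Finset.sum_congr rfl fun i _ => ?_
    rcases hbit (g (some i)) with h | h <;> simp [h]
  rw [hsum] at hrel
  have hcard : g none + ((Finset.univ.filter fun i => g (some i) = 1).card : ZMod 2) = 0 := by
    simpa [hε, hε₀] using congrArg ε hrel
  have hcard' : g none = ((Finset.univ.filter fun i => g (some i) = 1).card : ZMod 2) := by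
    rw [← CharTwo.add_eq_zero, hcard]
  refine ⟨Finset.univ.filter fun i => g (some i) = 1, ?_, ?_⟩
  · rw [Finset.nonempty_iff_ne_empty]
    intro h
    have hnone : g none = 0 := by simpa [h] using hcard'
    rcases o with _ | i
    · exact ho hnone
    · have hi : i ∈ Finset.univ.filter fun i => g (some i) = 1 :=
        Finset.mem_filter.2 ⟨Finset.mem_univ i, (hbit _).resolve_left ho⟩
      simp [h] at hi
  · rw [← hcard', eq_comm, ← sub_eq_zero, ZModModule.sub_eq_add]
    exact hrel

/-- The exponent vector of the monomial `x_i * x_j`, for `e = {i, j}`. -/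
noncomputable def edgeExponent {V : Type*} (e : Sym2 V) : V →₀ ℕ :=
  Sym2.lift ⟨fun i j => Finsupp.single i 1 + Finsupp.single j 1, fun _ _ => add_comm _ _⟩ e

lemma edgePoly_eq_monomial {V : Type} (K : Type) [CommRing K] (e : Sym2 V) :
    edgePoly K e = monomial (edgeExponent e) 1 := by
  induction e using Sym2.ind with
  | _ i j => simp [edgePoly, edgeExponent, X, monomial_mul]

lemma degree_edgeExponent {V : Type*} (e : Sym2 V) : (edgeExponent e).degree = 2 := by
  induction e using Sym2.ind with
  | _ i j => simp [edgeExponent]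

/-- Reduction modulo two of exponent vectors. -/
noncomputable def parity (V : Type*) : (V →₀ ℕ) →+ (V →₀ ZMod 2) :=
  Finsupp.mapRange.addMonoidHom (Nat.castAddMonoidHom (ZMod 2))

lemma parity_apply {V : Type*} (u : V →₀ ℕ) (v : V) : parity V u v = (u v : ZMod 2) := by
  simp [parity]

lemma parity_edgeExponent_mk {V : Type*} (i j : V) :
    parity V (edgeExponent s(i, j)) = Finsupp.single i 1 + Finsupp.single j 1 := by
  rw [edgeExponent, Sym2.lift_mk, map_add]
  simp [parity]

/-- Monomials of the same degree whose exponents agree modulo two are congruent modulo `J_V`. -/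
lemma monomial_sub_monomial_mem_JV {V : Type} [Finite V] (K : Type) [CommRing K] (u v : V →₀ ℕ)
    (hdeg : u.degree = v.degree) (hpar : parity V u = parity V v) :
    monomial u 1 - monomial v 1 ∈ JV V K := by
  have := Fintype.ofFinite V
  rcases isEmpty_or_nonempty V with hV | ⟨⟨p⟩⟩
  · simp [Subsingleton.elim u v]
  have hsq : ∀ i : V, Ideal.Quotient.mk (JV V K) (X i) ^ 2 =
      Ideal.Quotient.mk (JV V K) (X p) ^ 2 := fun i => by
    rw [← map_pow, ← map_pow]
    exact Ideal.Quotient.eq.2 (Ideal.subset_span ⟨i, p, rfl⟩)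
  have hmod : ∀ i, u i % 2 = v i % 2 := fun i => by
    have := DFunLike.congr_fun hpar i
    rw [parity_apply, parity_apply] at this
    exact (ZMod.natCast_eq_natCast_iff' _ _ 2).1 this
  have hmk : ∀ w : V →₀ ℕ, Ideal.Quotient.mk (JV V K) (monomial w 1) =
      (∏ i, Ideal.Quotient.mk (JV V K) (X i) ^ (w i % 2)) *
        (Ideal.Quotient.mk (JV V K) (X p) ^ 2) ^ ∑ i, w i / 2 := fun w => by
    rw [monomial_eq, Finsupp.prod_fintype _ _ (by simp), C_1, one_mul, map_prod,
      ← Finset.prod_pow_eq_pow_sum, ← Finset.prod_mul_distrib]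
    refine Finset.prod_congr rfl fun i _ => ?_
    rw [← hsq i, ← pow_mul, ← pow_add, Nat.mod_add_div, map_pow]
  have hhalf : ∑ i, u i / 2 = ∑ i, v i / 2 := by
    have key : ∀ w : V →₀ ℕ, w.degree = ∑ i, w i % 2 + 2 * ∑ i, w i / 2 := fun w => by
      rw [Finsupp.degree_eq_sum, Finset.mul_sum, ← Finset.sum_add_distrib]
      exact Finset.sum_congr rfl fun i _ => (Nat.mod_add_div _ _).symm
    have := (key u).symm.trans (hdeg.trans (key v))
    rw [Finset.sum_congr rfl fun i _ => hmod i] at this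
    omega
  rw [← Ideal.Quotient.eq, hmk, hmk, hhalf, Finset.prod_congr rfl fun i _ => by rw [hmod i]]

/-- A product of edge variables is congruent modulo `I(X_G)` to a power of `t_e` of the same degree
as soon as the parities of the images agree. -/
lemma prod_X_sub_pow_mem_IX {V : Type} [Finite V] (K : Type) [CommRing K] (G : SimpleGraph V)
    {ι : Type*} (S : Finset ι) (s : ι → G.edgeSet) (e : G.edgeSet)
    (h : ∑ i ∈ S, parity V (edgeExponent (s i : Sym2 V)) =
      (S.card : ZMod 2) • parity V (edgeExponent (e : Sym2 V))) :
    ∏ i ∈ S, X (s i) - X e ^ S.card ∈ IX K G := by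
  have hθ : thetaG K G (∏ i ∈ S, X (s i) - X e ^ S.card) =
      monomial (∑ i ∈ S, edgeExponent (s i : Sym2 V)) 1 -
        monomial (S.card • edgeExponent (e : Sym2 V)) 1 := by
    simp [thetaG, edgePoly_eq_monomial, monomial_pow, monomial_sum_one]
  rw [IX, Ideal.mem_comap, hθ]
  refine monomial_sub_monomial_mem_JV K _ _ ?_ ?_
  · simp [map_sum, degree_edgeExponent]
  · rw [map_sum, h, map_nsmul, Nat.cast_smul_eq_nsmul]

/-- The vectors over `ZMod 2` whose entries sum to zero on each connected component. -/
noncomputable def evenOnComponents {V : Type*} (G : SimpleGraph V) :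
    Submodule (ZMod 2) (V →₀ ZMod 2) :=
  LinearMap.ker (Finsupp.lmapDomain (ZMod 2) (ZMod 2) G.connectedComponentMk)

lemma finrank_evenOnComponents {V : Type*} [Fintype V] (G : SimpleGraph V) :
    Module.finrank (ZMod 2) (evenOnComponents G) =
      Fintype.card V - Nat.card G.ConnectedComponent := by
  classical
  have := Fintype.ofFinite G.ConnectedComponent
  have hsurj : Function.Surjective
      (Finsupp.lmapDomain (ZMod 2) (ZMod 2) G.connectedComponentMk) :=
    Finsupp.mapDomain_surjective Quot.mk_surjective
  have h := LinearMap.finrank_range_add_finrank_ker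
    (Finsupp.lmapDomain (ZMod 2) (ZMod 2) G.connectedComponentMk)
  rw [LinearMap.range_eq_top.2 hsurj, finrank_top, Module.finrank_finsupp_self,
    Module.finrank_finsupp_self] at h
  rw [evenOnComponents, Nat.card_eq_fintype_card]
  omega

lemma parity_edgeExponent_mem {V : Type*} (G : SimpleGraph V) {e : Sym2 V} (he : e ∈ G.edgeSet) :
    parity V (edgeExponent e) ∈ evenOnComponents G := by
  induction e using Sym2.ind with
  | _ i j =>
    have hij : G.connectedComponentMk i = G.connectedComponentMk j :=
      SimpleGraph.ConnectedComponent.sound (SimpleGraph.Adj.reachable he)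
    rw [parity_edgeExponent_mk, evenOnComponents, LinearMap.mem_ker, map_add]
    simp [hij, ZModModule.add_self]

/-- In a `2`-colored graph, counting the vertices of one color class yields one on every edge. -/
lemma linearCombination_color_parity_edgeExponent {V : Type*} (G : SimpleGraph V)
    (c : G.Coloring (Fin 2)) {e : Sym2 V} (he : e ∈ G.edgeSet) :
    Finsupp.linearCombination (ZMod 2) (fun v => ((c v : ℕ) : ZMod 2))
      (parity V (edgeExponent e)) = 1 := by
  induction e using Sym2.ind with
  | _ i j =>
    have hne : c i ≠ c j := c.valid he
    have hadd : ∀ a b : Fin 2, a ≠ b → ((a : ℕ) : ZMod 2) + ((b : ℕ) : ZMod 2) = 1 := by decide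
    simpa [parity_edgeExponent_mk] using hadd _ _ hne

lemma prod_X_mem_IX_sup_span {V : Type} [Fintype V] (K : Type) [CommRing K] (G : SimpleGraph V)
    (hbip : G.Colorable 2) (e : G.edgeSet) {ι : Type*} [Fintype ι]
    (hι : Fintype.card ι = Fintype.card V - Nat.card G.ConnectedComponent) (s : ι → G.edgeSet) :
    ∏ i, X (s i) ∈ IX K G ⊔ Ideal.span {X e} := by
  classical
  obtain ⟨c⟩ := hbip
  obtain ⟨S, hS, hsum⟩ := exists_nonempty_sum_eq_card_smul (evenOnComponents G)
    (by rw [finrank_evenOnComponents, hι]) (fun i => parity V (edgeExponent (s i : Sym2 V)))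
    (parity V (edgeExponent (e : Sym2 V))) (fun i => parity_edgeExponent_mem G (s i).2)
    (parity_edgeExponent_mem G e.2) _
    (fun i => linearCombination_color_parity_edgeExponent G c (s i).2)
    (linearCombination_color_parity_edgeExponent G c e.2)
  rw [← Finset.prod_mul_prod_compl S]
  refine Ideal.mul_mem_right _ _ ?_
  rw [← sub_add_cancel (∏ i ∈ S, X (s i)) (X e ^ S.card)]
  exact Submodule.add_mem_sup (prod_X_sub_pow_mem_IX K G S s e hsum)
    (Ideal.pow_mem_of_mem _ (Ideal.mem_span_singleton_self _) _ hS.card_pos)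

/-- If `G` is bipartite with `b₀(G)` connected components, then for any edge `e`, every
homogeneous polynomial of degree `|V_G| - b₀(G)` lies in `I(X_G) + (t_e)`.
(A regularity-free form of `reg I(X_G) ≤ |V_G| - b₀(G)` for bipartite `G`.) -/
theorem stmt16 {V K : Type} [Fintype V] [Field K] (G : SimpleGraph V)
    (hG : ∀ v : V, ∃ w : V, G.Adj v w) (hbip : G.Colorable 2)
    (e : Sym2 V) (he : e ∈ G.edgeSet)
    (f : MvPolynomial G.edgeSet K)
    (hf : f.IsHomogeneous (Fintype.card V - Nat.card G.ConnectedComponent)) :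
    f ∈ IX K G ⊔ Ideal.span {X (⟨e, he⟩ : G.edgeSet)} := by
  rw [f.as_sum]
  refine Ideal.sum_mem _ fun m hm => ?_
  have hdeg : m.degree = Fintype.card V - Nat.card G.ConnectedComponent := by
    rw [Finsupp.degree_eq_weight_one]
    exact hf (mem_support_iff.1 hm)
  rw [monomial_eq, Finsupp.prod]
  refine Ideal.mul_mem_left _ _ ?_
  have h := prod_X_mem_IX_sup_span K G hbip ⟨e, he⟩ (ι := Σ a : m.support, Fin (m a))
    (by rw [← hdeg, Fintype.card_sigma]; simp [Finsupp.degree_apply, Finset.sum_attach])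
    fun i => i.1
  rw [Fintype.prod_sigma] at h
  simpa [Finset.prod_attach m.support fun a => (X a : MvPolynomial G.edgeSet K) ^ m a] using h
end
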